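/- arXiv:2403.20094 — 2 statements merged into one kernel-verified Lean document; each statement's English description precedes it below -/
import Mathlib

section
/- Assume the non-resonant condition holds (β ∈ ℝ arbitrary). For all n ≠ m in ℕ there exist an integer s ≥ 1 and a word w ∈ R^s such that W(n,w) ≠ W(m,w). In fact, if m > n then the word w = ((−,+),(−,+),…,(−,+)) of length m satisfies W(m,w) > 0 while W(n,w) = 0. (Lemma 3.3: distinct Fock states produce distinct measurement-outcome statistics.) -/
open MeasureTheory Filter Real
open scoped ENNReal

noncomputable def pMinus (β ε : ℝ) : ℝ := 1 / (1 + Real.exp (-(β * ε)))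

noncomputable def pPlus (β ε : ℝ) : ℝ := Real.exp (-(β * ε)) / (1 + Real.exp (-(β * ε)))

noncomputable def rabiAlpha (ξ η : ℝ) (k : ℕ) : ℝ :=
  if k = 0 then 0
  else Real.sin (Real.pi * Real.sqrt (ξ * k + η)) ^ 2 * (ξ * k) / (ξ * k + η)

def IsRabiResonance (ξ η : ℝ) (n : ℕ) : Prop :=
  1 ≤ n ∧ ∃ j : ℕ, ξ * n + η = (j : ℝ) ^ 2

def NonResonant (ξ η : ℝ) : Prop := ∀ n : ℕ, ¬ IsRabiResonance ξ η n

noncomputable def bdKernel (β ε ξ η : ℝ) (k l : ℕ) : ℝ :=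
  if l = k + 1 then pPlus β ε * rabiAlpha ξ η (k + 1)
  else if l + 1 = k then pMinus β ε * rabiAlpha ξ η k
  else if l = k then 1 - pMinus β ε * rabiAlpha ξ η k - pPlus β ε * rabiAlpha ξ η (k + 1)
  else 0

noncomputable def muGibbs (β ε : ℝ) (k : ℕ) : ℝ :=
  (1 - Real.exp (-(β * ε))) * Real.exp (-(k : ℝ) * (β * ε))

noncomputable def bdKernelPow (β ε ξ η : ℝ) : ℕ → ℕ → ℕ → ℝ
  | 0, k, l => if k = l then 1 else 0
  | t + 1, k, l => ∑' j : ℕ, bdKernelPow β ε ξ η t k j * bdKernel β ε ξ η j l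

inductive Outcome : Type
  | mm | mp | pm | pp
  deriving DecidableEq

instance : MeasurableSpace Outcome := ⊤

noncomputable def stepWeight (β ε ξ η : ℝ) (k : ℕ) : Outcome → ℝ
  | .mm => pMinus β ε * (1 - rabiAlpha ξ η k)
  | .mp => pMinus β ε * rabiAlpha ξ η k
  | .pm => pPlus β ε * rabiAlpha ξ η (k + 1)
  | .pp => pPlus β ε * (1 - rabiAlpha ξ η (k + 1))

def stepSucc (k : ℕ) : Outcome → ℕ
  | .mm => k
  | .mp => k - 1
  | .pm => k + 1
  | .pp => k

noncomputable def wordWeight (β ε ξ η : ℝ) : ℕ → List Outcome → ℝ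
  | _, [] => 1
  | k, a :: w => stepWeight β ε ξ η k a * wordWeight β ε ξ η (stepSucc k a) w

def cylinder (w : List Outcome) : Set (ℕ → Outcome) :=
  {ω | ∀ i : Fin w.length, ω i = w.get i}

def outDelta : Outcome → ℤ
  | .mp => -1
  | .pm => 1
  | _ => 0

def sShift (ω : ℕ → Outcome) (t : ℕ) : ℤ := ∑ u ∈ Finset.range t, outDelta (ω u)

noncomputable def tauExt (k : ℕ) (ω : ℕ → Outcome) : ℕ∞ :=
  sInf ((fun t : ℕ => (t : ℕ∞)) '' {t : ℕ | 1 ≤ t ∧ (k : ℤ) + sShift ω t < 0})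

noncomputable def NFock (k : ℕ) (ω : ℕ → Outcome) (t : ℕ) : ℤ :=
  if (t : ℕ∞) < tauExt k ω then (k : ℤ) + sShift ω t else -1

noncomputable def firstReturn (k : ℕ) (ω : ℕ → Outcome) : ℕ∞ :=
  sInf ((fun t : ℕ => (t : ℕ∞)) '' {t : ℕ | 1 ≤ t ∧ NFock k ω t = (k : ℤ)})

theorem aux_alpha_pos (ξ η : ℝ) (hξ : 0 < ξ) (hη : 0 ≤ η) (hnr : NonResonant ξ η)
    (k : ℕ) (hk : 1 ≤ k) : 0 < rabiAlpha ξ η k := by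
  have hk0 : (0 : ℝ) < k := by exact_mod_cast hk
  have h1 : 0 < ξ * k := mul_pos hξ hk0
  have h2 : 0 < ξ * k + η := by linarith
  have hs : Real.sin (Real.pi * Real.sqrt (ξ * k + η)) ≠ 0 := by
    intro h
    obtain ⟨j, hj⟩ := Real.sin_eq_zero_iff.mp h
    have hj' : (j : ℝ) = Real.sqrt (ξ * k + η) := by
      have hp := Real.pi_ne_zero
      rw [mul_comm] at hj
      exact mul_left_cancel₀ hp hj
    refine hnr k ⟨hk, j.natAbs, ?_⟩
    have h3 : ((j.natAbs : ℕ) : ℝ) ^ 2 = (j : ℝ) ^ 2 := by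
      rw [Nat.cast_natAbs, Int.cast_abs, sq_abs]
    rw [h3, hj', Real.sq_sqrt h2.le]
  unfold rabiAlpha
  rw [if_neg (by omega)]
  positivity

theorem aux_pMinus_pos (β ε : ℝ) : 0 < pMinus β ε := by
  unfold pMinus
  positivity

theorem aux_pos (β ε ξ η : ℝ) (hξ : 0 < ξ) (hη : 0 ≤ η) (hnr : NonResonant ξ η) (m : ℕ) :
    0 < wordWeight β ε ξ η m (List.replicate m Outcome.mp) := by
  induction m with
  | zero => simp [wordWeight]
  | succ k ih =>
    rw [List.replicate_succ]
    exact mul_pos (mul_pos (aux_pMinus_pos β ε)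
      (aux_alpha_pos ξ η hξ hη hnr (k + 1) (by omega))) ih

theorem aux_zero (β ε ξ η : ℝ) (m : ℕ) : ∀ n : ℕ, n < m →
    wordWeight β ε ξ η n (List.replicate m Outcome.mp) = 0 := by
  induction m with
  | zero => intro n h; omega
  | succ k ih =>
    intro n h
    rw [List.replicate_succ]
    rcases n with _ | n
    · simp [wordWeight, stepWeight, rabiAlpha]
    · have := ih n (by omega)
      simp [wordWeight, stepSucc, this]

/-- Lemma 3.3: under the non-resonant condition, distinct Fock states give
distinct outcome statistics; in fact if `m > n` the word `((−,+),…,(−,+))` of length `m`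
has positive weight from `m` and zero weight from `n`. -/
theorem statement5 (ε β ξ η : ℝ) (hε : 0 < ε) (hξ : 0 < ξ) (hη : 0 ≤ η)
    (hnr : NonResonant ξ η) :
    ∀ n m : ℕ, n ≠ m →
      (∃ s : ℕ, 1 ≤ s ∧ ∃ w : List Outcome, w.length = s ∧
        wordWeight β ε ξ η n w ≠ wordWeight β ε ξ η m w) ∧
      (n < m →
        0 < wordWeight β ε ξ η m (List.replicate m Outcome.mp) ∧
        wordWeight β ε ξ η n (List.replicate m Outcome.mp) = 0) := by
  intro n m hnm
  refine ⟨?_, fun h => ⟨aux_pos β ε ξ η hξ hη hnr m, aux_zero β ε ξ η m n h⟩⟩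
  rcases lt_or_gt_of_ne hnm with h | h
  · refine ⟨m, by omega, List.replicate m Outcome.mp, by simp, ?_⟩
    rw [aux_zero β ε ξ η m n h]
    exact (aux_pos β ε ξ η hξ hη hnr m).ne
  · refine ⟨n, by omega, List.replicate n Outcome.mp, by simp, ?_⟩
    rw [aux_zero β ε ξ η n m h]
    exact (aux_pos β ε ξ η hξ hη hnr n).ne'
end

section
/- Assume the non-resonant condition holds and β > 0. Let A_k = {ω ∈ Ω : N_t(k,ω) = k for infinitely many t} and A = ∪_{k∈ℕ} A_k. Then ℙ_{μ_Gibbs}(A) = 1. Moreover, for every ω ∈ A there exists a strictly increasing sequence of integers (t_j)_j such that for every k ∈ ℕ: if τᵏ(ω) = ∞ then N_{t_j}(k,ω) = k for all j, and if τᵏ(ω) < ∞ then N_{t_j}(k,ω) = −1 for all sufficiently large j. (Proposition 4.2.) -/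
open MeasureTheory Filter Real
open scoped ENNReal

instance : Finite Outcome :=
  Finite.of_surjective (fun i : Fin 4 => (![Outcome.mm, .mp, .pm, .pp] : Fin 4 → Outcome) i)
    (by
      intro b
      cases b
      · exact ⟨0, rfl⟩
      · exact ⟨1, rfl⟩
      · exact ⟨2, rfl⟩
      · exact ⟨3, rfl⟩)

instance : MeasurableSingletonClass Outcome := ⟨fun _ => trivial⟩

def shMap (ω : ℕ → Outcome) : ℕ → Outcome := fun n => ω (n + 1)

def TMap (x : ℕ × (ℕ → Outcome)) : ℕ × (ℕ → Outcome) := (stepSucc x.1 (x.2 0), shMap x.2)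

lemma measurable_shMap : Measurable shMap :=
  measurable_pi_lambda _ fun n => measurable_pi_apply (n + 1)

lemma measurable_TMap : Measurable TMap := by
  refine Measurable.prodMk ?_ (measurable_shMap.comp measurable_snd)
  have h1 : Measurable (fun x : ℕ × (ℕ → Outcome) => (x.1, x.2 0)) :=
    measurable_fst.prodMk ((measurable_pi_apply 0).comp measurable_snd)
  exact (measurable_of_countable (fun y : ℕ × Outcome => stepSucc y.1 y.2)).comp h1

lemma measurableSet_cylinder' (w : List Outcome) : MeasurableSet (cylinder w) := by
  have : cylinder w = ⋂ i : Fin w.length, (fun ω : ℕ → Outcome => ω i) ⁻¹' {w.get i} := by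
    ext ω; simp [_root_.cylinder]
  rw [this]
  exact MeasurableSet.iInter fun i => (measurable_pi_apply _) (measurableSet_singleton _)

lemma mem_cylinder_iff (w : List Outcome) (ω : ℕ → Outcome) :
    ω ∈ cylinder w ↔ ∀ (i : ℕ) (h : i < w.length), ω i = w[i] := by
  simp [_root_.cylinder, Fin.forall_iff]

lemma mem_cylinder_ofFn (ω : ℕ → Outcome) (n : ℕ) (ω' : ℕ → Outcome) :
    ω' ∈ cylinder (List.ofFn (fun i : Fin n => ω i)) ↔ ∀ i < n, ω' i = ω i := by
  simp [mem_cylinder_iff]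

lemma cyl_pi : IsPiSystem (Set.range cylinder) := by
  rintro _ ⟨w, rfl⟩ _ ⟨v, rfl⟩ ⟨ω, hw, hv⟩
  refine ⟨List.ofFn (fun i : Fin (max w.length v.length) => ω i), ?_⟩
  ext ω'
  rw [mem_cylinder_ofFn, Set.mem_inter_iff, mem_cylinder_iff, mem_cylinder_iff]
  rw [mem_cylinder_iff] at hw hv
  constructor
  · intro h
    refine ⟨fun i hi => ?_, fun i hi => ?_⟩
    · rw [h i (lt_max_of_lt_left hi), hw i hi]
    · rw [h i (lt_max_of_lt_right hi), hv i hi]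
  · rintro ⟨h1, h2⟩ i hi
    rcases lt_max_iff.1 hi with h | h
    · rw [h1 i h, hw i h]
    · rw [h2 i h, hv i h]

lemma cyl_gen : (MeasurableSpace.pi : MeasurableSpace (ℕ → Outcome)) =
    MeasurableSpace.generateFrom (Set.range cylinder) := by
  apply le_antisymm
  · refine iSup_le fun i => ?_
    rintro _ ⟨S, -, rfl⟩
    have : (fun ω : ℕ → Outcome => ω i) ⁻¹' S =
        ⋃ (w : List Outcome) (_ : cylinder w ⊆ (fun ω : ℕ → Outcome => ω i) ⁻¹' S),
          cylinder w := by
      ext ω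
      simp only [Set.mem_iUnion, exists_prop]
      constructor
      · intro h
        refine ⟨List.ofFn (fun j : Fin (i + 1) => ω j), ?_, ?_⟩
        · intro ω' h'
          rw [mem_cylinder_ofFn] at h'
          rw [Set.mem_preimage, h' i (by omega)]
          exact h
        · rw [mem_cylinder_ofFn]; intros; rfl
      · rintro ⟨w, h, h'⟩
        exact h h'
    rw [this]
    let _ := MeasurableSpace.generateFrom (Set.range cylinder)
    exact MeasurableSet.iUnion fun w => MeasurableSet.iUnion fun _ =>
      MeasurableSpace.measurableSet_generateFrom ⟨w, rfl⟩
  · apply MeasurableSpace.generateFrom_le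
    rintro _ ⟨w, rfl⟩
    exact measurableSet_cylinder' w

lemma cyl_ext (μ ν : Measure (ℕ → Outcome)) [IsFiniteMeasure μ]
    (h : ∀ w, μ (cylinder w) = ν (cylinder w)) : μ = ν := by
  refine ext_of_generate_finite _ cyl_gen cyl_pi ?_ ?_
  · rintro _ ⟨w, rfl⟩; exact h w
  · have : cylinder [] = Set.univ := by ext; simp [_root_.cylinder]
    rw [← this]; exact h []

lemma cylinder_cons (a : Outcome) (w : List Outcome) :
    shMap ⁻¹' cylinder w ∩ {ω | ω 0 = a} = cylinder (a :: w) := by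
  ext ω
  simp only [Set.mem_inter_iff, Set.mem_preimage, mem_cylinder_iff, Set.mem_ofPred_eq, shMap]
  constructor
  · rintro ⟨h1, h2⟩ i hi
    cases i with
    | zero => simpa using h2
    | succ i => simpa using h1 i (by simpa using hi)
  · intro h
    refine ⟨fun i hi => ?_, ?_⟩
    · have := h (i + 1) (by simpa using hi)
      rwa [List.getElem_cons_succ] at this
    · have := h 0 (by simp)
      rwa [List.getElem_cons_zero] at this

lemma alpha_nonneg {ξ η : ℝ} (hξ : 0 < ξ) (hη : 0 ≤ η) (k : ℕ) : 0 ≤ rabiAlpha ξ η k := by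
  unfold rabiAlpha; split_ifs
  · exact le_rfl
  · positivity

lemma alpha_le {ξ η : ℝ} (hξ : 0 < ξ) (hη : 0 ≤ η) (k : ℕ) : rabiAlpha ξ η k ≤ 1 := by
  unfold rabiAlpha; split_ifs with h
  · exact zero_le_one
  · have hk : (0 : ℝ) < k := by exact_mod_cast Nat.pos_of_ne_zero h
    have hp : 0 < ξ * k := by positivity
    rw [div_le_one (by positivity)]
    nlinarith [Real.sin_sq_le_one (Real.pi * Real.sqrt (ξ * k + η))]

lemma pMinus_nonneg (β ε : ℝ) : 0 ≤ pMinus β ε := by unfold pMinus; positivity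
lemma pPlus_nonneg (β ε : ℝ) : 0 ≤ pPlus β ε := by unfold pPlus; positivity
lemma p_sum (β ε : ℝ) : pMinus β ε + pPlus β ε = 1 := by
  unfold pMinus pPlus
  have : 0 < Real.exp (-(β * ε)) := Real.exp_pos _
  field_simp

lemma stepWeight_nonneg {β ε ξ η : ℝ} (hξ : 0 < ξ) (hη : 0 ≤ η) (k : ℕ) (a : Outcome) :
    0 ≤ stepWeight β ε ξ η k a := by
  have h1 := alpha_nonneg hξ hη k
  have h2 := alpha_nonneg hξ hη (k + 1)
  have h3 := alpha_le hξ hη k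
  have h4 := alpha_le hξ hη (k + 1)
  cases a <;> simp only [stepWeight]
  · exact mul_nonneg (pMinus_nonneg _ _) (by linarith)
  · exact mul_nonneg (pMinus_nonneg _ _) (by linarith)
  · exact mul_nonneg (pPlus_nonneg _ _) (by linarith)
  · exact mul_nonneg (pPlus_nonneg _ _) (by linarith)

lemma balance (β ε ξ η : ℝ) (k : ℕ) :
    muGibbs β ε (k + 1) * stepWeight β ε ξ η (k + 1) .mp =
      muGibbs β ε k * stepWeight β ε ξ η k .pm := by
  simp only [stepWeight, muGibbs, pMinus, pPlus]
  have : Real.exp (-((k + 1 : ℕ) : ℝ) * (β * ε)) =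
      Real.exp (-(k : ℝ) * (β * ε)) * Real.exp (-(β * ε)) := by
    rw [← Real.exp_add]; congr 1; push_cast; ring
  rw [this]; ring

lemma muGibbs_nonneg {β ε : ℝ} (hε : 0 < ε) (hβ : 0 < β) (k : ℕ) : 0 ≤ muGibbs β ε k := by
  unfold muGibbs
  have : Real.exp (-(β * ε)) ≤ 1 := Real.exp_le_one_iff.2 (by nlinarith [mul_pos hβ hε])
  exact mul_nonneg (by linarith) (Real.exp_pos _).le

lemma muGibbs_pos {β ε : ℝ} (hε : 0 < ε) (hβ : 0 < β) (k : ℕ) : 0 < muGibbs β ε k := by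
  unfold muGibbs
  have : Real.exp (-(β * ε)) < 1 := Real.exp_lt_one_iff.2 (by nlinarith [mul_pos hβ hε])
  exact mul_pos (by linarith) (Real.exp_pos _)

lemma muGibbs_tsum {β ε : ℝ} (hε : 0 < ε) (hβ : 0 < β) :
    ∑' k, ENNReal.ofReal (muGibbs β ε k) = 1 := by
  have h1 : Real.exp (-(β * ε)) < 1 := Real.exp_lt_one_iff.2 (by nlinarith [mul_pos hβ hε])
  have h := (hasSum_geometric_of_lt_one (Real.exp_pos (-(β * ε))).le h1).mul_left
    (1 - Real.exp (-(β * ε)))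
  rw [mul_inv_cancel₀ (by linarith)] at h
  have h2 : (fun k : ℕ => (1 - Real.exp (-(β * ε))) * Real.exp (-(β * ε)) ^ k) =
      muGibbs β ε := by
    ext k
    rw [muGibbs, ← Real.exp_nat_mul]; congr 2; ring
  rw [h2] at h
  rw [← ENNReal.ofReal_tsum_of_nonneg (muGibbs_nonneg hε hβ) h.summable, h.tsum_eq,
    ENNReal.ofReal_one]

lemma key_markov {β ε ξ η : ℝ} (hξ : 0 < ξ) (hη : 0 ≤ η)
    (P : ℕ → MeasureTheory.Measure (ℕ → Outcome))
    (hP : ∀ k, MeasureTheory.IsProbabilityMeasure (P k))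
    (hcyl : ∀ k (w : List Outcome),
      P k (cylinder w) = ENNReal.ofReal (wordWeight β ε ξ η k w))
    (k : ℕ) (a : Outcome) (B : Set (ℕ → Outcome)) (hB : MeasurableSet B) :
    P k (shMap ⁻¹' B ∩ {ω | ω 0 = a}) =
      ENNReal.ofReal (stepWeight β ε ξ η k a) * P (stepSucc k a) B := by
  have : ((P k).restrict {ω | ω 0 = a}).map shMap =
      ENNReal.ofReal (stepWeight β ε ξ η k a) • P (stepSucc k a) := by
    have := hP k
    apply cyl_ext
    intro w
    rw [Measure.map_apply measurable_shMap (measurableSet_cylinder' w),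
      Measure.restrict_apply (measurable_shMap (measurableSet_cylinder' w)), cylinder_cons,
      hcyl, wordWeight, ENNReal.ofReal_mul (stepWeight_nonneg hξ hη k a), Measure.smul_apply,
      hcyl, smul_eq_mul]
  have h2 := congrArg (fun m => m B) this
  simpa [Measure.map_apply measurable_shMap hB,
      Measure.restrict_apply (measurable_shMap hB)] using h2

noncomputable def MMeas (β ε : ℝ) (P : ℕ → Measure (ℕ → Outcome)) :
    Measure (ℕ × (ℕ → Outcome)) :=
  Measure.sum (fun k => ENNReal.ofReal (muGibbs β ε k) • (P k).map (Prod.mk k))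

lemma MMeas_apply (β ε : ℝ) (P : ℕ → Measure (ℕ → Outcome)) {S : Set (ℕ × (ℕ → Outcome))}
    (hS : MeasurableSet S) :
    MMeas β ε P S = ∑' k, ENNReal.ofReal (muGibbs β ε k) * P k {ω | (k, ω) ∈ S} := by
  rw [MMeas, Measure.sum_apply _ hS]
  congr 1; ext k
  rw [Measure.smul_apply, Measure.map_apply measurable_prodMk_left hS]; rfl

lemma tsum_invariant {β ε ξ η : ℝ} (hε : 0 < ε) (hβ : 0 < β) (hξ : 0 < ξ) (hη : 0 ≤ η)
    (f : ℕ → ℝ≥0∞) :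
    ∑' k, ENNReal.ofReal (muGibbs β ε k) *
      (ENNReal.ofReal (stepWeight β ε ξ η k .mm) * f k +
       ENNReal.ofReal (stepWeight β ε ξ η k .mp) * f (k - 1) +
       ENNReal.ofReal (stepWeight β ε ξ η k .pm) * f (k + 1) +
       ENNReal.ofReal (stepWeight β ε ξ η k .pp) * f k) =
    ∑' k, ENNReal.ofReal (muGibbs β ε k) * f k := by
  have hz : stepWeight β ε ξ η 0 .mp = 0 := by simp [stepWeight, rabiAlpha]
  have hb : ∀ k, ENNReal.ofReal (muGibbs β ε (k + 1)) *
      ENNReal.ofReal (stepWeight β ε ξ η (k + 1) .mp) = ENNReal.ofReal (muGibbs β ε k) *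
      ENNReal.ofReal (stepWeight β ε ξ η k .pm) := fun k => by
    rw [← ENNReal.ofReal_mul (muGibbs_nonneg hε hβ _),
      ← ENNReal.ofReal_mul (muGibbs_nonneg hε hβ _), balance]
  have h1 : ∑' k, ENNReal.ofReal (muGibbs β ε k) *
      ENNReal.ofReal (stepWeight β ε ξ η k .mp) * f (k - 1) =
      ∑' k, ENNReal.ofReal (muGibbs β ε k) *
      ENNReal.ofReal (stepWeight β ε ξ η k .pm) * f k := by
    rw [tsum_eq_zero_add' ENNReal.summable, hz]
    simp [hb]
  have h2 : ∑' k, ENNReal.ofReal (muGibbs β ε k) *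
      ENNReal.ofReal (stepWeight β ε ξ η k .mp) * f k =
      ∑' k, ENNReal.ofReal (muGibbs β ε k) *
      ENNReal.ofReal (stepWeight β ε ξ η k .pm) * f (k + 1) := by
    rw [tsum_eq_zero_add' ENNReal.summable, hz]
    simp [hb]
  have hs : ∀ k, ENNReal.ofReal (stepWeight β ε ξ η k .mm) +
       ENNReal.ofReal (stepWeight β ε ξ η k .pm) +
       ENNReal.ofReal (stepWeight β ε ξ η k .mp) +
       ENNReal.ofReal (stepWeight β ε ξ η k .pp) = 1 := fun k => by
    have hn := stepWeight_nonneg (β := β) (ε := ε) hξ hη k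
    rw [← ENNReal.ofReal_add (hn _) (hn _), ← ENNReal.ofReal_add (add_nonneg (hn _) (hn _)) (hn _),
      ← ENNReal.ofReal_add (add_nonneg (add_nonneg (hn _) (hn _)) (hn _)) (hn _),
      ← ENNReal.ofReal_one]
    congr 1
    simp only [stepWeight]
    linear_combination p_sum β ε
  simp only [mul_add, ← mul_assoc, ENNReal.tsum_add]
  rw [h1, ← h2]
  simp only [← ENNReal.tsum_add]
  congr 1; ext k
  simp only [← add_mul, ← mul_add, hs, mul_one]

lemma MMeas_preserving {β ε ξ η : ℝ} (hε : 0 < ε) (hβ : 0 < β) (hξ : 0 < ξ) (hη : 0 ≤ η)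
    (P : ℕ → MeasureTheory.Measure (ℕ → Outcome))
    (hP : ∀ k, MeasureTheory.IsProbabilityMeasure (P k))
    (hcyl : ∀ k (w : List Outcome),
      P k (cylinder w) = ENNReal.ofReal (wordWeight β ε ξ η k w)) :
    MeasurePreserving TMap (MMeas β ε P) (MMeas β ε P) := by
  refine ⟨measurable_TMap, ?_⟩
  ext S hS
  rw [Measure.map_apply measurable_TMap hS, MMeas_apply _ _ _ (measurable_TMap hS),
    MMeas_apply _ _ _ hS, ← tsum_invariant (ξ := ξ) (η := η) hε hβ hξ hη
      (fun l => P l {ω | (l, ω) ∈ S})]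
  congr 1; ext k
  congr 1
  set E : Set (ℕ → Outcome) := {ω | (k, ω) ∈ TMap ⁻¹' S}
  have hE : MeasurableSet E := measurable_prodMk_left (measurable_TMap hS)
  have hm : ∀ a : Outcome, MeasurableSet {ω : ℕ → Outcome | ω 0 = a} := fun a =>
    measurableSet_eq_fun (measurable_pi_apply 0) measurable_const
  have hk : ∀ a, P k (E ∩ {ω | ω 0 = a}) = ENNReal.ofReal (stepWeight β ε ξ η k a) *
      P (stepSucc k a) {ω | (stepSucc k a, ω) ∈ S} := fun a => by
    have hB : MeasurableSet {ω | (stepSucc k a, ω) ∈ S} := measurable_prodMk_left hS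
    rw [← key_markov hξ hη P hP hcyl k a _ hB]
    congr 1
    ext ω
    simp only [E, Set.mem_inter_iff, Set.mem_preimage, Set.mem_ofPred_eq, TMap]
    constructor
    · rintro ⟨h, rfl⟩; exact ⟨h, rfl⟩
    · rintro ⟨h, rfl⟩; exact ⟨h, rfl⟩
  have hd : E = (((E ∩ {ω | ω 0 = .mm}) ∪ (E ∩ {ω | ω 0 = .mp})) ∪ (E ∩ {ω | ω 0 = .pm})) ∪
      (E ∩ {ω | ω 0 = .pp}) := by
    ext ω
    simp only [Set.mem_union, Set.mem_inter_iff, Set.mem_ofPred_eq]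
    cases ω 0 <;> simp
  rw [hd, measure_union _ (hE.inter (hm _)), measure_union _ (hE.inter (hm _)),
    measure_union _ (hE.inter (hm _)), hk, hk, hk, hk]
  · rfl
  all_goals
    rw [Set.disjoint_left]
    intro ω
    simp only [Set.mem_union, Set.mem_inter_iff, Set.mem_ofPred_eq]
    cases ω 0 <;> simp

def badSet : Set (ℕ × (ℕ → Outcome)) := {x | x.1 = 0 ∧ x.2 0 = .mp}

lemma TMap_iter_snd (x : ℕ × (ℕ → Outcome)) (t : ℕ) :
    (TMap^[t] x).2 = fun n => x.2 (n + t) := by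
  induction t with
  | zero => rfl
  | succ t ih =>
    rw [Function.iterate_succ_apply']
    funext n
    change (TMap^[t] x).2 (n + 1) = _
    rw [ih]
    change x.2 (n + 1 + t) = x.2 (n + (t + 1))
    rw [show n + 1 + t = n + (t + 1) by ring]

lemma TMap_iter_fst (k : ℕ) (ω : ℕ → Outcome) (h : ∀ t, TMap^[t] (k, ω) ∉ badSet) (t : ℕ) :
    ((TMap^[t] (k, ω)).1 : ℤ) = k + sShift ω t := by
  induction t with
  | zero => simp [sShift]
  | succ t ih =>
    have hb := h t
    rw [Function.iterate_succ_apply']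
    simp only [badSet, Set.mem_ofPred_eq, TMap_iter_snd, zero_add] at hb
    simp only [TMap, TMap_iter_snd, zero_add]
    rw [sShift, Finset.sum_range_succ, ← sShift, ← add_assoc, ← ih]
    generalize (TMap^[t] (k, ω)).1 = m at *
    generalize ω t = a at *
    cases a <;> simp [stepSucc, outDelta] at *
    omega

lemma tau_top_iff (k : ℕ) (ω : ℕ → Outcome) :
    tauExt k ω = ⊤ ↔ ∀ t, 1 ≤ t → 0 ≤ (k : ℤ) + sShift ω t := by
  simp only [tauExt, sInf_eq_top]
  constructor
  · intro h t ht
    by_contra hc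
    exact ENat.natCast_ne_top t (h _ ⟨t, ⟨ht, by omega⟩, rfl⟩)
  · rintro h _ ⟨t, ⟨ht, hc⟩, rfl⟩
    have := h t ht
    omega

lemma NFock_top {k : ℕ} {ω : ℕ → Outcome} (h : tauExt k ω = ⊤) (t : ℕ) :
    NFock k ω t = k + sShift ω t := by
  rw [NFock, h, if_pos (ENat.natCast_lt_top t)]

lemma good_imp (k : ℕ) (ω : ℕ → Outcome) (h : ∀ t, TMap^[t] (k, ω) ∉ badSet)
    (hf : ∃ᶠ t in atTop, (TMap^[t] (k, ω)).1 = k) :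
    {t : ℕ | NFock k ω t = (k : ℤ)}.Infinite := by
  have ht : tauExt k ω = ⊤ := by
    rw [tau_top_iff]; intro t _
    rw [← TMap_iter_fst k ω h]; positivity
  rw [← Nat.frequently_atTop_iff_infinite]
  refine hf.mono fun t h' => ?_
  rw [NFock_top ht, ← TMap_iter_fst k ω h, h']

lemma part2 (ω : ℕ → Outcome)
    (hω : ω ∈ ⋃ k : ℕ, {ω : ℕ → Outcome | {t : ℕ | NFock k ω t = (k : ℤ)}.Infinite}) :
      ∃ ts : ℕ → ℕ, StrictMono ts ∧
        ∀ k : ℕ,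
          (tauExt k ω = ⊤ → ∀ j : ℕ, NFock k ω (ts j) = (k : ℤ)) ∧
          (tauExt k ω < ⊤ → ∃ J : ℕ, ∀ j ≥ J, NFock k ω (ts j) = -1) := by
  obtain ⟨m, hm⟩ := Set.mem_iUnion.1 hω
  have hm : {t : ℕ | NFock m ω t = (m : ℤ)}.Infinite := hm
  have h0 : {t : ℕ | sShift ω t = 0}.Infinite := by
    refine hm.mono fun t ht => ?_
    simp only [Set.mem_ofPred_eq, NFock] at ht ⊢
    split_ifs at ht <;> omega
  refine ⟨Nat.nth (fun t => sShift ω t = 0), Nat.nth_strictMono h0, fun k => ⟨fun h j => ?_,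
    fun h => ?_⟩⟩
  · rw [NFock_top h, Nat.nth_mem_of_infinite h0 j, add_zero]
  · obtain ⟨n, hn⟩ := ENat.ne_top_iff_exists.1 h.ne
    refine ⟨n, fun j hj => ?_⟩
    rw [NFock, if_neg]
    rw [← hn, not_lt]
    exact_mod_cast hj.trans ((Nat.nth_strictMono h0).le_apply)

lemma part1 {β ε ξ η : ℝ} (hε : 0 < ε) (hβ : 0 < β) (hξ : 0 < ξ) (hη : 0 ≤ η)
    (P : ℕ → MeasureTheory.Measure (ℕ → Outcome))
    (hP : ∀ k, MeasureTheory.IsProbabilityMeasure (P k))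
    (hcyl : ∀ k (w : List Outcome),
      P k (cylinder w) = ENNReal.ofReal (wordWeight β ε ξ η k w)) (k : ℕ) :
    ∀ᵐ ω ∂(P k), {t : ℕ | NFock k ω t = (k : ℤ)}.Infinite := by
  have hpres := MMeas_preserving hε hβ hξ hη P hP hcyl
  have hfin : IsFiniteMeasure (MMeas β ε P) := by
    constructor
    rw [MMeas_apply _ _ _ MeasurableSet.univ]
    simp [muGibbs_tsum hε hβ]
  have hcons := hpres.conservative
  have hbm : MeasurableSet badSet := by
    have h1 : Measurable (fun x : ℕ × (ℕ → Outcome) => x.2 0) :=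
      (measurable_pi_apply 0).comp measurable_snd
    exact (measurable_fst (measurableSet_singleton 0)).inter
      (h1 (measurableSet_singleton Outcome.mp))
  have hb0 : MMeas β ε P badSet = 0 := by
    rw [MMeas_apply _ _ _ hbm, ENNReal.tsum_eq_zero]
    intro k
    rcases Nat.eq_zero_or_pos k with rfl | hk
    · have h := hcyl 0 [.mp]
      have h' : {ω : ℕ → Outcome | (0, ω) ∈ badSet} = cylinder [.mp] := by
        ext ω; simp [badSet, _root_.cylinder]
      rw [h', h]
      simp [wordWeight, stepWeight, rabiAlpha]
    · have h' : {ω : ℕ → Outcome | (k, ω) ∈ badSet} = ∅ := by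
        ext ω; simp [badSet, hk.ne']
      rw [h']; simp
  have hae1 : ∀ᵐ x ∂(MMeas β ε P), ∀ t, TMap^[t] x ∉ badSet := by
    rw [ae_all_iff]
    intro t
    have := (hpres.iterate t).measure_preimage hbm.nullMeasurableSet
    rw [hb0] at this
    exact measure_eq_zero_iff_ae_notMem.1 this
  have hae2 := hcons.ae_mem_imp_frequently_image_mem
    (s := Prod.fst ⁻¹' {k}) (measurable_fst (measurableSet_singleton k)).nullMeasurableSet
  have hae := hae1.and hae2
  rw [MMeas, Measure.ae_sum_iff] at hae
  have h1 := hae k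
  rw [Measure.ae_ennreal_smul_measure_iff
    (by simpa using muGibbs_pos hε hβ k)] at h1
  have h2 := ae_of_ae_map measurable_prodMk_left.aemeasurable h1
  filter_upwards [h2] with ω hω
  exact good_imp k ω hω.1 (hω.2 rfl)

/-- Proposition 4.2: under the non-resonant condition and `β > 0`,
`ℙ_{μ_Gibbs}(A) = 1` with `A = ⋃ₖ A_k`, and every `ω ∈ A` admits a strictly increasing
sequence of times `(t_j)` along which each `k` either returns to `k` (if `τᵏ(ω) = ∞`) or
ends in the cemetery `-1` (if `τᵏ(ω) < ∞`). -/
theorem statement10 (ε β ξ η : ℝ) (hε : 0 < ε) (hβ : 0 < β) (hξ : 0 < ξ) (hη : 0 ≤ η)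
    (hnr : NonResonant ξ η)
    (P : ℕ → MeasureTheory.Measure (ℕ → Outcome))
    (hP : ∀ k, MeasureTheory.IsProbabilityMeasure (P k))
    (hcyl : ∀ k (w : List Outcome),
      P k (cylinder w) = ENNReal.ofReal (wordWeight β ε ξ η k w)) :
    (MeasureTheory.Measure.sum (fun k => ENNReal.ofReal (muGibbs β ε k) • P k))
      (⋃ k : ℕ, {ω | {t : ℕ | NFock k ω t = (k : ℤ)}.Infinite}) = 1 ∧
    ∀ ω ∈ ⋃ k : ℕ, {ω : ℕ → Outcome | {t : ℕ | NFock k ω t = (k : ℤ)}.Infinite},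
      ∃ ts : ℕ → ℕ, StrictMono ts ∧
        ∀ k : ℕ,
          (tauExt k ω = ⊤ → ∀ j : ℕ, NFock k ω (ts j) = (k : ℤ)) ∧
          (tauExt k ω < ⊤ → ∃ J : ℕ, ∀ j ≥ J, NFock k ω (ts j) = -1) := by
  refine ⟨?_, fun ω hω => part2 ω hω⟩
  have hae : ∀ᵐ ω ∂(Measure.sum (fun k => ENNReal.ofReal (muGibbs β ε k) • P k)),
      ω ∈ ⋃ k : ℕ, {ω | {t : ℕ | NFock k ω t = (k : ℤ)}.Infinite} := by
    rw [Measure.ae_sum_iff]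
    intro k
    refine Measure.ae_smul_measure ?_ _
    filter_upwards [part1 hε hβ hξ hη P hP hcyl k] with ω hω
    exact Set.mem_iUnion.2 ⟨k, hω⟩
  have hu := measure_congr (s := ⋃ k : ℕ, {ω | {t : ℕ | NFock k ω t = (k : ℤ)}.Infinite})
    (t := Set.univ) (eventuallyEq_univ.2 hae)
  rw [hu, Measure.sum_apply _ MeasurableSet.univ]
  simp [muGibbs_tsum hε hβ]
end
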